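/- arXiv:2302.01759 — 5 statements merged into one kernel-verified Lean document; each statement's English description precedes it below -/
import Mathlib

section
/- For every δ with 0 ≤ δ < minᵢ λᵢ and every x ∈ ℝ^M, the function f_α admits the closed-form expansion f_α(δ) = (1/2)·( xᵀU(L−δI)L⁻²Uᵀx + (1/α)·( xᵀx + xᵀU(L−δI)²L⁻²Uᵀx − 2·xᵀU(L−δI)L⁻¹Uᵀx ) ). -/
open Matrix

/-- `W(δ) = U · diag(√(λᵢ − δ))`. -/
noncomputable def Wmat {M P : ℕ} (U : Matrix (Fin M) (Fin P) ℝ) (lam : Fin P → ℝ)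
    (δ : ℝ) : Matrix (Fin M) (Fin P) ℝ :=
  U * Matrix.diagonal (fun i => Real.sqrt (lam i - δ))

/-- `ẑ(δ) = L⁻¹ · diag(√(λᵢ − δ)) · Uᵀ x`. -/
noncomputable def zhat {M P : ℕ} (U : Matrix (Fin M) (Fin P) ℝ) (lam : Fin P → ℝ)
    (δ : ℝ) (x : Fin M → ℝ) : Fin P → ℝ :=
  ((Matrix.diagonal lam)⁻¹ * Matrix.diagonal (fun i => Real.sqrt (lam i - δ)) * Uᵀ).mulVec x

/-- Squared Euclidean norm on `ℝ^M`. -/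
noncomputable def enormSq {M : ℕ} (v : Fin M → ℝ) : ℝ :=
  ‖(EuclideanSpace.equiv (Fin M) ℝ).symm v‖ ^ 2

/-- `f_α(δ) = (1/2)·(ẑ(δ)ᵀẑ(δ) + (1/α)·‖x − W(δ)ẑ(δ)‖²)`. -/
noncomputable def fA {M P : ℕ} (U : Matrix (Fin M) (Fin P) ℝ) (lam : Fin P → ℝ)
    (x : Fin M → ℝ) (α δ : ℝ) : ℝ :=
  (1 / 2) * (zhat U lam δ x ⬝ᵥ zhat U lam δ x +
    (1 / α) * enormSq (x - (Wmat U lam δ).mulVec (zhat U lam δ x)))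

/-- The quadratic form of `U * diagonal d * Uᵀ` is diagonal in the coordinates `Uᵀ x`. -/
theorem dotProduct_mul_diagonal_mul_transpose_mulVec {m n R : Type*} [Fintype m] [Fintype n]
    [DecidableEq n] [CommSemiring R] (U : Matrix m n R) (d : n → R) (x : m → R) :
    x ⬝ᵥ (U * diagonal d * Uᵀ).mulVec x = ∑ i, d i * (Uᵀ *ᵥ x) i ^ 2 := by
  rw [Matrix.mul_assoc, ← mulVec_mulVec, dotProduct_mulVec, ← mulVec_transpose,
    ← mulVec_mulVec, dotProduct]
  refine Finset.sum_congr rfl fun i _ => ?_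
  rw [mulVec_diagonal]
  ring

/-- A matrix with orthonormal columns preserves the dot product. -/
theorem mulVec_dotProduct_mulVec_of_transpose_mul_self {m n R : Type*} [Fintype m] [Fintype n]
    [DecidableEq n] [CommSemiring R] {U : Matrix m n R} (hU : Uᵀ * U = 1) (v w : n → R) :
    (U *ᵥ v) ⬝ᵥ (U *ᵥ w) = v ⬝ᵥ w := by
  rw [dotProduct_mulVec, ← mulVec_transpose, mulVec_mulVec, hU, one_mulVec]

theorem enormSq_eq_dotProduct {M : ℕ} (v : Fin M → ℝ) : enormSq v = v ⬝ᵥ v := by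
  rw [enormSq, EuclideanSpace.real_norm_sq_eq, dotProduct]
  exact Finset.sum_congr rfl fun i _ => pow_two (v i)

theorem inv_diagonal_of_pos {n : Type*} [Fintype n] [DecidableEq n] {d : n → ℝ}
    (hd : ∀ i, 0 < d i) : (diagonal d)⁻¹ = diagonal fun i => (d i)⁻¹ := by
  refine inv_eq_right_inv ?_
  rw [diagonal_mul_diagonal, ← diagonal_one]
  exact congrArg diagonal (funext fun i => mul_inv_cancel₀ (hd i).ne')

/-- closed-form expansion of `f_α(δ)`. -/
theorem fA_closed_form (M P : ℕ) (hM : 0 < M) (hP : 0 < P)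
    (x : Fin M → ℝ)
    (U : Matrix (Fin M) (Fin P) ℝ)
    (hU : Uᵀ * U = (1 : Matrix (Fin P) (Fin P) ℝ))
    (lam : Fin P → ℝ) (hlam : ∀ i, 0 < lam i)
    (α : ℝ) (hα : 0 < α)
    (δ : ℝ) (hδ0 : 0 ≤ δ) (hδ : ∀ i, δ < lam i) :
    fA U lam x α δ =
      (1 / 2) *
        (x ⬝ᵥ (U * (Matrix.diagonal lam - δ • 1) * (Matrix.diagonal lam)⁻¹ ^ 2 * Uᵀ).mulVec x +
          (1 / α) *
            (x ⬝ᵥ x +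
              x ⬝ᵥ (U * (Matrix.diagonal lam - δ • 1) ^ 2 * (Matrix.diagonal lam)⁻¹ ^ 2 * Uᵀ).mulVec x -
              2 * (x ⬝ᵥ (U * (Matrix.diagonal lam - δ • 1) * (Matrix.diagonal lam)⁻¹ * Uᵀ).mulVec x))) := by
  have hS : diagonal lam - δ • (1 : Matrix (Fin P) (Fin P) ℝ) =
      diagonal fun i => lam i - δ := by
    rw [smul_one_eq_diagonal, diagonal_sub]
  set y : Fin P → ℝ := Uᵀ *ᵥ x with hy
  have hsq (i : Fin P) : √(lam i - δ) * √(lam i - δ) = lam i - δ :=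
    Real.mul_self_sqrt (sub_nonneg.2 (hδ i).le)
  have hz : zhat U lam δ x = fun i => (lam i)⁻¹ * √(lam i - δ) * y i := by
    funext i
    rw [zhat, inv_diagonal_of_pos hlam, diagonal_mul_diagonal, ← mulVec_mulVec, mulVec_diagonal]
  have hWz : Wmat U lam δ *ᵥ zhat U lam δ x = U *ᵥ fun i => (lam i - δ) * (lam i)⁻¹ * y i := by
    rw [hz, Wmat, ← mulVec_mulVec]
    congr 1
    funext i
    rw [mulVec_diagonal]
    linear_combination (lam i)⁻¹ * y i * hsq i
  have hcross (w : Fin P → ℝ) : x ⬝ᵥ U *ᵥ w = y ⬝ᵥ w := by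
    rw [dotProduct_mulVec, ← mulVec_transpose]
  have hnorm : zhat U lam δ x ⬝ᵥ zhat U lam δ x =
      ∑ i, (lam i - δ) * (lam i)⁻¹ ^ 2 * y i ^ 2 := by
    rw [hz, dotProduct]
    refine Finset.sum_congr rfl fun i _ => ?_
    linear_combination (lam i)⁻¹ ^ 2 * y i ^ 2 * hsq i
  have hresid : enormSq (x - Wmat U lam δ *ᵥ zhat U lam δ x) =
      x ⬝ᵥ x + ∑ i, (lam i - δ) ^ 2 * (lam i)⁻¹ ^ 2 * y i ^ 2 -
        2 * ∑ i, (lam i - δ) * (lam i)⁻¹ * y i ^ 2 := by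
    have hself : (fun i => (lam i - δ) * (lam i)⁻¹ * y i) ⬝ᵥ
        (fun i => (lam i - δ) * (lam i)⁻¹ * y i) =
        ∑ i, (lam i - δ) ^ 2 * (lam i)⁻¹ ^ 2 * y i ^ 2 :=
      Finset.sum_congr rfl fun i _ => by ring
    have hmixed : (y ⬝ᵥ fun i => (lam i - δ) * (lam i)⁻¹ * y i) =
        ∑ i, (lam i - δ) * (lam i)⁻¹ * y i ^ 2 :=
      Finset.sum_congr rfl fun i _ => by ring
    rw [enormSq_eq_dotProduct, hWz, sub_dotProduct, dotProduct_sub, dotProduct_sub,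
      mulVec_dotProduct_mulVec_of_transpose_mul_self hU, dotProduct_comm (U *ᵥ _) x, hcross,
      hself, hmixed]
    ring
  rw [fA, hnorm, hresid, hS, inv_diagonal_of_pos hlam]
  simp only [diagonal_pow, Matrix.mul_assoc U (diagonal _) (diagonal _), diagonal_mul_diagonal,
    dotProduct_mul_diagonal_mul_transpose_mulVec, Pi.pow_apply, ← hy]
end

section
/- Suppose 0 < α < minᵢ λᵢ. Then f_α is a convex function of δ on the interval [0, minᵢ λᵢ): for all δ₁, δ₂ in this interval and all t ∈ [0,1], f_α(t·δ₁ + (1−t)·δ₂) ≤ t·f_α(δ₁) + (1−t)·f_α(δ₂). -/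
open Matrix

theorem zhat_apply {M P : ℕ} (U : Matrix (Fin M) (Fin P) ℝ) (lam : Fin P → ℝ)
    (hlam : ∀ i, lam i ≠ 0) (δ : ℝ) (x : Fin M → ℝ) (i : Fin P) :
    zhat U lam δ x i = (lam i)⁻¹ * Real.sqrt (lam i - δ) * (Uᵀ *ᵥ x) i := by
  have hinv : (diagonal lam)⁻¹ = diagonal fun i => (lam i)⁻¹ :=
    inv_eq_right_inv (by simp [diagonal_mul_diagonal, hlam])
  rw [zhat, hinv, diagonal_mul_diagonal, ← mulVec_mulVec, mulVec_diagonal]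

theorem Wmat_mulVec_zhat {M P : ℕ} (U : Matrix (Fin M) (Fin P) ℝ) (lam : Fin P → ℝ)
    (hlam : ∀ i, lam i ≠ 0) (δ : ℝ) (hδ : ∀ i, δ ≤ lam i) (x : Fin M → ℝ) :
    Wmat U lam δ *ᵥ zhat U lam δ x = U *ᵥ fun i => (1 - δ / lam i) * (Uᵀ *ᵥ x) i := by
  rw [Wmat, ← mulVec_mulVec]
  congr 1
  ext i
  rw [mulVec_diagonal, zhat_apply U lam hlam]
  have hsqrt := Real.mul_self_sqrt (sub_nonneg.2 (hδ i))
  have hi := hlam i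
  field_simp
  linear_combination (Uᵀ *ᵥ x) i * hsqrt

/-- Pythagoras for the orthogonal projection onto the column space of `U`. -/
theorem sub_mulVec_dotProduct_self {M P : ℕ} (U : Matrix (Fin M) (Fin P) ℝ)
    (hU : Uᵀ * U = 1) (x : Fin M → ℝ) (w : Fin P → ℝ) :
    (x - U *ᵥ w) ⬝ᵥ (x - U *ᵥ w) =
      x ⬝ᵥ x - (Uᵀ *ᵥ x) ⬝ᵥ (Uᵀ *ᵥ x) + (Uᵀ *ᵥ x - w) ⬝ᵥ (Uᵀ *ᵥ x - w) := by
  have hcross : x ⬝ᵥ U *ᵥ w = (Uᵀ *ᵥ x) ⬝ᵥ w := by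
    rw [dotProduct_mulVec, mulVec_transpose]
  have hsq : (U *ᵥ w) ⬝ᵥ (U *ᵥ w) = w ⬝ᵥ w := by
    rw [dotProduct_mulVec, ← mulVec_transpose, mulVec_mulVec, hU, one_mulVec]
  simp only [sub_dotProduct, dotProduct_sub, dotProduct_comm (U *ᵥ w) x,
    dotProduct_comm w (Uᵀ *ᵥ x), hcross, hsq]
  ring

/-- `f_α` is a quadratic polynomial in `δ`. -/
theorem fA_eq_quadratic {M P : ℕ} (U : Matrix (Fin M) (Fin P) ℝ) (hU : Uᵀ * U = 1)
    (lam : Fin P → ℝ) (hlam : ∀ i, lam i ≠ 0) (x : Fin M → ℝ) (α δ : ℝ)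
    (hδ : ∀ i, δ ≤ lam i) :
    fA U lam x α δ = (1 / 2) * (∑ i, (Uᵀ *ᵥ x) i ^ 2 / lam i
      - δ * ∑ i, ((Uᵀ *ᵥ x) i / lam i) ^ 2
      + (1 / α) * (x ⬝ᵥ x - (Uᵀ *ᵥ x) ⬝ᵥ (Uᵀ *ᵥ x)
        + δ ^ 2 * ∑ i, ((Uᵀ *ᵥ x) i / lam i) ^ 2)) := by
  rw [fA, enormSq_eq_dotProduct, Wmat_mulVec_zhat U lam hlam δ hδ,
    sub_mulVec_dotProduct_self U hU]
  congr 2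
  · simp only [dotProduct, Finset.mul_sum, ← Finset.sum_sub_distrib]
    refine Finset.sum_congr rfl fun i _ => ?_
    rw [zhat_apply U lam hlam]
    have hsqrt := Real.mul_self_sqrt (sub_nonneg.2 (hδ i))
    have hi := hlam i
    field_simp
    linear_combination (Uᵀ *ᵥ x) i ^ 2 * hsqrt
  · congr 2
    rw [dotProduct, Finset.mul_sum]
    refine Finset.sum_congr rfl fun i _ => ?_
    rw [Pi.sub_apply]
    ring

/-- `f_α` is convex on `[0, minᵢ λᵢ)`. -/
theorem fA_convex (M P : ℕ) (hM : 0 < M) (hP : 0 < P)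
    (x : Fin M → ℝ)
    (U : Matrix (Fin M) (Fin P) ℝ)
    (hU : Uᵀ * U = (1 : Matrix (Fin P) (Fin P) ℝ))
    (lam : Fin P → ℝ) (hlam : ∀ i, 0 < lam i)
    (α : ℝ) (hα : 0 < α) (hαlam : ∀ i, α < lam i) :
    ∀ δ₁ δ₂ t : ℝ, 0 ≤ δ₁ → (∀ i, δ₁ < lam i) → 0 ≤ δ₂ → (∀ i, δ₂ < lam i) →
      0 ≤ t → t ≤ 1 →
      fA U lam x α (t * δ₁ + (1 - t) * δ₂) ≤
        t * fA U lam x α δ₁ + (1 - t) * fA U lam x α δ₂ := by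
  intro δ₁ δ₂ t _ h₁ _ h₂ ht₀ ht₁
  have hne : ∀ i, lam i ≠ 0 := fun i => (hlam i).ne'
  have hmid : ∀ i, t * δ₁ + (1 - t) * δ₂ ≤ lam i := fun i => by
    nlinarith [mul_le_mul_of_nonneg_left (h₁ i).le ht₀,
      mul_le_mul_of_nonneg_left (h₂ i).le (sub_nonneg.2 ht₁)]
  rw [fA_eq_quadratic U hU lam hne x α _ hmid,
    fA_eq_quadratic U hU lam hne x α δ₁ fun i => (h₁ i).le,
    fA_eq_quadratic U hU lam hne x α δ₂ fun i => (h₂ i).le]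
  set S := ∑ i, ((Uᵀ *ᵥ x) i / lam i) ^ 2
  have hS : 0 ≤ S := Finset.sum_nonneg fun i _ => sq_nonneg _
  have hgap : 0 ≤ (1 / 2) * (1 / α) * S * (t * (1 - t) * (δ₁ - δ₂) ^ 2) := by
    have := sub_nonneg.2 ht₁
    positivity
  linarith
end

section
/- At δ = 0 the PPCA anomaly score reduces exactly to the MSNM combination of the D- and Q-statistics: f_α(0) = (1/2)·( xᵀU L⁻¹ Uᵀx + (1/α)·‖x − U Uᵀ x‖² ), where xᵀU L⁻¹ Uᵀx is the D-statistic (Hotelling's T²) and ‖x − U Uᵀ x‖² is the Q-statistic (squared prediction error) of the observation x. -/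
open Matrix

/-- at `δ = 0` the PPCA anomaly score reduces exactly to the MSNM
combination of the `D`-statistic `xᵀU L⁻¹ Uᵀx` and the `Q`-statistic
`‖x − U Uᵀ x‖²`. -/
theorem fA_zero_eq_MSNM (M P : ℕ) (hM : 0 < M) (hP : 0 < P)
    (x : Fin M → ℝ)
    (U : Matrix (Fin M) (Fin P) ℝ)
    (hU : Uᵀ * U = (1 : Matrix (Fin P) (Fin P) ℝ))
    (lam : Fin P → ℝ) (hlam : ∀ i, 0 < lam i)
    (α : ℝ) (hα : 0 < α) :
    fA U lam x α 0 =
      (1 / 2) * (x ⬝ᵥ (U * (Matrix.diagonal lam)⁻¹ * Uᵀ).mulVec x +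
        (1 / α) * enormSq (x - (U * Uᵀ).mulVec x)) := by
  have hinv : (diagonal lam)⁻¹ = diagonal fun i => (lam i)⁻¹ :=
    inv_eq_right_inv <| by
      simp [diagonal_mul_diagonal, fun i => mul_inv_cancel₀ (hlam i).ne']
  have hsqrt : ∀ i, √(lam i) * √(lam i) = lam i := fun i => Real.mul_self_sqrt (hlam i).le
  have hz : zhat U lam 0 x = diagonal (fun i => (lam i)⁻¹ * √(lam i)) *ᵥ (Uᵀ *ᵥ x) := by
    simp [zhat, hinv, diagonal_mul_diagonal]
  have hW : Wmat U lam 0 *ᵥ zhat U lam 0 x = (U * Uᵀ) *ᵥ x := by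
    rw [hz, Wmat, mulVec_mulVec, mulVec_mulVec, Matrix.mul_assoc U,
      diagonal_mul_diagonal]
    have h : (fun i => √(lam i - 0) * ((lam i)⁻¹ * √(lam i))) = fun _ => 1 := by
      funext i
      rw [sub_zero, mul_left_comm, hsqrt, inv_mul_cancel₀ (hlam i).ne']
    rw [h, diagonal_one, Matrix.mul_one]
  have hD : zhat U lam 0 x ⬝ᵥ zhat U lam 0 x =
      x ⬝ᵥ (U * (diagonal lam)⁻¹ * Uᵀ) *ᵥ x := by
    rw [hz, hinv, ← mulVec_mulVec, ← mulVec_mulVec, dotProduct_mulVec x U, ← mulVec_transpose]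
    refine Finset.sum_congr rfl fun i _ => ?_
    simp only [mulVec_diagonal]
    have hi := (hlam i).ne'
    field_simp
    rw [Real.sq_sqrt (hlam i).le]
  rw [fA, hW, hD]
end

section
/- Let W be an M×P real matrix, σ² > 0, C = W Wᵀ + σ²·I_M, M' = WᵀW + σ²·I_P, and for x ∈ ℝ^M set ẑ = (M')⁻¹ Wᵀ x. Then xᵀ C⁻¹ x = ẑᵀ ẑ + σ⁻²·‖x − W ẑ‖². -/
open Matrix

/-- A Gram matrix plus a positive multiple of the identity is invertible. -/
theorem isUnit_det_mul_transpose_add_smul_one {m n : Type*} [Fintype m] [DecidableEq m]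
    [Fintype n] (A : Matrix m n ℝ) {s : ℝ} (hs : 0 < s) :
    IsUnit (A * Aᵀ + s • (1 : Matrix m m ℝ)).det := by
  have h : (A * Aᵀ).PosSemidef := by
    simpa [conjTranspose_eq_transpose_of_trivial] using posSemidef_self_mul_conjTranspose A
  exact (PosDef.posSemidef_add h (PosDef.one.smul hs)).det_pos.ne'.isUnit

/-- with `C = W Wᵀ + σ²·I_M`, `M' = WᵀW + σ²·I_P` and
`ẑ = (M')⁻¹ Wᵀ x`, one has `xᵀ C⁻¹ x = ẑᵀ ẑ + σ⁻²·‖x − W ẑ‖²`. -/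
theorem ppca_quadratic_split (M P : ℕ) (hM : 0 < M) (hP : 0 < P)
    (W : Matrix (Fin M) (Fin P) ℝ) (σsq : ℝ) (hσ : 0 < σsq)
    (x : Fin M → ℝ)
    (zh : Fin P → ℝ)
    (hzh : zh = ((Wᵀ * W + σsq • (1 : Matrix (Fin P) (Fin P) ℝ))⁻¹ * Wᵀ).mulVec x) :
    x ⬝ᵥ ((W * Wᵀ + σsq • (1 : Matrix (Fin M) (Fin M) ℝ))⁻¹).mulVec x =
      zh ⬝ᵥ zh + σsq⁻¹ * enormSq (x - W.mulVec zh) := by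
  have hC := isUnit_det_mul_transpose_add_smul_one W hσ
  have hM' := isUnit_det_mul_transpose_add_smul_one Wᵀ hσ
  rw [transpose_transpose] at hM'
  have normal_eq : Wᵀ *ᵥ (W *ᵥ zh) + σsq • zh = Wᵀ *ᵥ x := by
    have h : (Wᵀ * W + σsq • (1 : Matrix (Fin P) (Fin P) ℝ)) *ᵥ zh = Wᵀ *ᵥ x := by
      rw [hzh, mulVec_mulVec, mul_nonsing_inv_cancel_left _ _ hM']
    simpa [add_mulVec, smul_mulVec, mulVec_mulVec] using h
  obtain ⟨r, hr⟩ : ∃ r, r = x - W *ᵥ zh := ⟨_, rfl⟩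
  have hx : x = W *ᵥ zh + r := by rw [hr]; abel
  have hWr : Wᵀ *ᵥ r = σsq • zh := by
    rw [hr, mulVec_sub, ← normal_eq]; abel
  have hCr : (W * Wᵀ + σsq • (1 : Matrix (Fin M) (Fin M) ℝ)) *ᵥ r = σsq • x := by
    rw [add_mulVec, ← mulVec_mulVec, hWr, smul_mulVec, one_mulVec, mulVec_smul, ← smul_add, ← hx]
  have hinv : (W * Wᵀ + σsq • (1 : Matrix (Fin M) (Fin M) ℝ))⁻¹ *ᵥ x = σsq⁻¹ • r := by
    rw [← inv_smul_smul₀ hσ.ne' x, ← hCr, mulVec_smul, mulVec_mulVec, nonsing_inv_mul _ hC,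
      one_mulVec]
  have hWzr : (W *ᵥ zh) ⬝ᵥ r = σsq * (zh ⬝ᵥ zh) := by
    rw [dotProduct_comm, dotProduct_mulVec, ← mulVec_transpose, hWr, smul_dotProduct, smul_eq_mul]
  rw [hinv, ← hr, enormSq_eq_dotProduct, dotProduct_smul, smul_eq_mul]
  nth_rw 1 [hx]
  rw [add_dotProduct, hWzr, mul_add, inv_mul_cancel_left₀ hσ.ne']
end

section
/- Suppose 0 < δ < minᵢ λᵢ, and let C(δ) = W(δ)W(δ)ᵀ + δ·I_M with W(δ) = U · diag(√(λᵢ − δ)) and ẑ(δ) = L⁻¹ · diag(√(λᵢ − δ)) · Uᵀ x. Then the PPCA quadratic form splits exactly into the regularization and reconstruction terms: xᵀ C(δ)⁻¹ x = ẑ(δ)ᵀẑ(δ) + δ⁻¹·‖x − W(δ)ẑ(δ)‖². -/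
open Matrix

/-- A ridge-regression solution `z` splits the quadratic form of `(W Wᵀ + δ I)⁻¹`. -/
theorem dotProduct_inv_mulVec_of_normal_eq {m n : Type*} [Fintype m] [Fintype n]
    [DecidableEq m] (W : Matrix m n ℝ) {δ : ℝ} (hδ : 0 < δ) (x : m → ℝ) (z : n → ℝ)
    (hz : Wᵀ *ᵥ (x - W *ᵥ z) = δ • z) :
    x ⬝ᵥ (W * Wᵀ + δ • (1 : Matrix m m ℝ))⁻¹ *ᵥ x =
      z ⬝ᵥ z + δ⁻¹ * ((x - W *ᵥ z) ⬝ᵥ (x - W *ᵥ z)) := by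
  set r := x - W *ᵥ z with hr
  have hx : x = r + W *ᵥ z := by simp [hr]
  have hC : IsUnit (W * Wᵀ + δ • (1 : Matrix m m ℝ)).det := by
    rw [← Matrix.isUnit_iff_isUnit_det]
    refine (Matrix.PosDef.posSemidef_add ?_ (Matrix.PosDef.one.smul hδ)).isUnit
    simpa using Matrix.posSemidef_self_mul_conjTranspose W
  have hCr : (W * Wᵀ + δ • (1 : Matrix m m ℝ)) *ᵥ r = δ • x := by
    rw [add_mulVec, ← mulVec_mulVec, hz, mulVec_smul, smul_mulVec, one_mulVec, ← smul_add,
      add_comm, ← hx]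
  have hinv : (W * Wᵀ + δ • (1 : Matrix m m ℝ))⁻¹ *ᵥ x = δ⁻¹ • r := by
    rw [eq_inv_smul_iff₀ hδ.ne', ← mulVec_smul, ← hCr, mulVec_mulVec, nonsing_inv_mul _ hC,
      one_mulVec]
  have hWr : (W *ᵥ z) ⬝ᵥ r = δ * (z ⬝ᵥ z) := by
    rw [dotProduct_comm, dotProduct_mulVec, ← mulVec_transpose, hz, smul_dotProduct, smul_eq_mul]
  rw [hinv, dotProduct_smul, smul_eq_mul, hx, add_dotProduct, hWr]
  field_simp
  ring

theorem Wmat_transpose_mul_self {M P : ℕ} {U : Matrix (Fin M) (Fin P) ℝ} (hU : Uᵀ * U = 1)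
    {lam : Fin P → ℝ} {δ : ℝ} (hδ : ∀ i, δ ≤ lam i) :
    (Wmat U lam δ)ᵀ * Wmat U lam δ = diagonal fun i => lam i - δ := by
  rw [Wmat, transpose_mul, diagonal_transpose, Matrix.mul_assoc, ← Matrix.mul_assoc Uᵀ, hU,
    Matrix.one_mul, diagonal_mul_diagonal]
  simp only [Real.mul_self_sqrt (sub_nonneg.2 (hδ _))]

theorem diagonal_mulVec_zhat {M P : ℕ} (U : Matrix (Fin M) (Fin P) ℝ) {lam : Fin P → ℝ}
    (hlam : ∀ i, lam i ≠ 0) (δ : ℝ) (x : Fin M → ℝ) :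
    diagonal lam *ᵥ zhat U lam δ x = (Wmat U lam δ)ᵀ *ᵥ x := by
  have hdet : IsUnit (diagonal lam).det := by
    rw [det_diagonal]
    exact (Finset.prod_ne_zero_iff.2 fun i _ => hlam i).isUnit
  rw [zhat, mulVec_mulVec, Matrix.mul_assoc, mul_nonsing_inv_cancel_left _ _ hdet, Wmat,
    transpose_mul, diagonal_transpose]

theorem Wmat_transpose_mulVec_residual {M P : ℕ} {U : Matrix (Fin M) (Fin P) ℝ}
    (hU : Uᵀ * U = 1) {lam : Fin P → ℝ} (hlam : ∀ i, lam i ≠ 0) {δ : ℝ}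
    (hδ : ∀ i, δ ≤ lam i) (x : Fin M → ℝ) :
    (Wmat U lam δ)ᵀ *ᵥ (x - Wmat U lam δ *ᵥ zhat U lam δ x) = δ • zhat U lam δ x := by
  rw [mulVec_sub, ← diagonal_mulVec_zhat U hlam, mulVec_mulVec, Wmat_transpose_mul_self hU hδ]
  ext i
  simp only [Pi.sub_apply, mulVec_diagonal, Pi.smul_apply, smul_eq_mul]
  ring

/-- for `0 < δ < minᵢ λᵢ`, with `C(δ) = W(δ)W(δ)ᵀ + δ·I_M`, the
PPCA quadratic form splits exactly into regularization and reconstruction terms: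
`xᵀ C(δ)⁻¹ x = ẑ(δ)ᵀẑ(δ) + δ⁻¹·‖x − W(δ)ẑ(δ)‖²`. -/
theorem ppca_quadratic_split_closed (M P : ℕ) (hM : 0 < M) (hP : 0 < P)
    (x : Fin M → ℝ)
    (U : Matrix (Fin M) (Fin P) ℝ)
    (hU : Uᵀ * U = (1 : Matrix (Fin P) (Fin P) ℝ))
    (lam : Fin P → ℝ) (hlam : ∀ i, 0 < lam i)
    (δ : ℝ) (hδ0 : 0 < δ) (hδ : ∀ i, δ < lam i) :
    x ⬝ᵥ ((Wmat U lam δ * (Wmat U lam δ)ᵀ +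
        δ • (1 : Matrix (Fin M) (Fin M) ℝ))⁻¹).mulVec x =
      zhat U lam δ x ⬝ᵥ zhat U lam δ x +
        δ⁻¹ * enormSq (x - (Wmat U lam δ).mulVec (zhat U lam δ x)) := by
  rw [enormSq_eq_dotProduct]
  exact dotProduct_inv_mulVec_of_normal_eq _ hδ0 _ _
    (Wmat_transpose_mulVec_residual hU (fun i => (hlam i).ne') (fun i => (hδ i).le) x)
end
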